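/- Let ε ∈ {0, 1}, let f₅, f₆ : ℝ → ℝ be C² functions whose derivatives f₅′, f₆′ are nowhere zero, and let φ : ℝ⁶ → ℝ be a C² function satisfying, at every point x = (x¹,…,x⁶) ∈ ℝ⁶ and for each τ ∈ {5, 6}: (i) ∂₁φ = 0, ∂₂φ = 0 and ∂₃φ = 0; (ii) ∂₅∂₆φ = 0 and ∂₄∂_τφ = 0; (iii) 4ε·∂_τφ(x) = f_τ′(x^τ)·∂₄φ(x); (iv) f_τ′(x^τ)·∂_τ∂_τφ(x) = f_τ″(x^τ)·∂_τφ(x); (v) f₆′(x⁶)·∂₅φ(x) = f₅′(x⁵)·∂₆φ(x). Then there exist constants a₁, c ∈ ℝ such that φ(x) = 2a₁ε·x⁴ + (a₁/2)(f₅(x⁵) + f₆(x⁶)) + c for all x ∈ ℝ⁶. -/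

import Mathlib

/-- Partial derivative of `φ : ℝ⁶ → ℝ` in the `i`-th coordinate direction
(`i : Fin 6` is the 0-based index, so `∂ᵢφ` of the paper is `pd (i-1) φ`). -/
noncomputable def pd (i : Fin 6) (φ : (Fin 6 → ℝ) → ℝ) : (Fin 6 → ℝ) → ℝ :=
  fun x => fderiv ℝ φ x (Pi.single i 1)

theorem ContDiff.differentiable_pd {φ : (Fin 6 → ℝ) → ℝ} (hφ : ContDiff ℝ 2 φ) (i : Fin 6) :
    Differentiable ℝ (pd i φ) :=
  ((hφ.fderiv_right (m := 1) (by norm_num)).differentiable (by norm_num)).clm_apply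
    (differentiable_const _)

theorem pd_comm {φ : (Fin 6 → ℝ) → ℝ} (hφ : ContDiff ℝ 2 φ) (i j : Fin 6)
    (x : Fin 6 → ℝ) : pd i (pd j φ) x = pd j (pd i φ) x := by
  have hd : DifferentiableAt ℝ (fderiv ℝ φ) x :=
    (hφ.fderiv_right (m := 1) (by norm_num)).differentiable (by norm_num) x
  have key (i j : Fin 6) : pd i (pd j φ) x =
      fderiv ℝ (fderiv ℝ φ) x (Pi.single i 1) (Pi.single j 1) := by
    unfold pd
    rw [fderiv_clm_apply hd (differentiableAt_const _)]
    simp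
  rw [key, key]
  exact hφ.contDiffAt.isSymmSndFDerivAt (by simp) _ _

/-- A differentiable function on `ℝ⁶` whose partial derivatives all vanish is constant. -/
theorem eq_of_pd_eq_zero {g : (Fin 6 → ℝ) → ℝ} (hg : Differentiable ℝ g)
    (h : ∀ i x, pd i g x = 0) (x y : Fin 6 → ℝ) : g x = g y := by
  refine is_const_of_fderiv_eq_zero (𝕜 := ℝ) hg (fun z => ?_) x y
  refine ContinuousLinearMap.coe_injective (LinearMap.pi_ext' fun i => ?_)
  ext
  simpa [pd] using h i z

theorem HasDerivAt.hasFDerivAt_comp_coord {v : ℝ → ℝ} {v' : ℝ} {k : Fin 6} {x : Fin 6 → ℝ}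
    (hv : HasDerivAt v v' (x k)) :
    HasFDerivAt (fun y : Fin 6 → ℝ => v (y k))
      (v' • ContinuousLinearMap.proj (R := ℝ) (φ := fun _ : Fin 6 => ℝ) k) x :=
  hv.comp_hasFDerivAt x (ContinuousLinearMap.proj (R := ℝ) (φ := fun _ : Fin 6 => ℝ) k).hasFDerivAt

/-- If `∂ₖφ` depends only on the `k`-th coordinate and satisfies `f' ∂ₖ∂ₖφ = f'' ∂ₖφ`, then
`∂ₖφ` is a constant multiple of `f'`. -/
theorem exists_pd_eq_mul_deriv {φ : (Fin 6 → ℝ) → ℝ} (hφ : ContDiff ℝ 2 φ) {f : ℝ → ℝ}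
    (hf : ContDiff ℝ 2 f) (hf' : ∀ s, deriv f s ≠ 0) {k : Fin 6}
    (hne : ∀ i, i ≠ k → ∀ x, pd i (pd k φ) x = 0)
    (hk : ∀ x, deriv f (x k) * pd k (pd k φ) x = deriv (deriv f) (x k) * pd k φ x) :
    ∃ b : ℝ, ∀ x, pd k φ x = b * deriv f (x k) := by
  have hd2 (s : ℝ) : HasDerivAt (deriv f) (deriv (deriv f) s) s :=
    (hf.differentiable_deriv_two s).hasDerivAt
  have hg (x : Fin 6 → ℝ) := ((hφ.differentiable_pd k) x).hasFDerivAt.mul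
    ((hd2 (x k)).fun_inv (hf' (x k))).hasFDerivAt_comp_coord
  have hconst := eq_of_pd_eq_zero (fun x => (hg x).differentiableAt) fun i x => by
    rw [pd, (hg x).fderiv]
    have h0 := hf' (x k)
    by_cases hik : i = k
    · subst hik
      have h := hk x
      rw [pd] at h
      simp
      field_simp
      linear_combination h
    · have h := hne i hik x
      rw [pd] at h
      simp [h, Ne.symm hik]
  refine ⟨pd k φ 0 * (deriv f ((0 : Fin 6 → ℝ) k))⁻¹, fun x => ?_⟩
  have h := hconst x 0
  simp only [Pi.mul_apply] at h
  rw [← h, mul_assoc, inv_mul_cancel₀ (hf' _), mul_one]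

/-- Integration of the Eisenhart equations for the defining function of a
projective motion on the rigid 6-dimensional h-space of type [411] (generic case
f₅′, f₆′ nowhere zero). Coordinates: x¹,…,x⁶ are `x 0, …, x 5`. -/
theorem stmt_6 (ε : ℝ) (hε : ε = 0 ∨ ε = 1)
    (f₅ f₆ : ℝ → ℝ) (hf₅ : ContDiff ℝ 2 f₅) (hf₆ : ContDiff ℝ 2 f₆)
    (hf₅' : ∀ s : ℝ, deriv f₅ s ≠ 0) (hf₆' : ∀ t : ℝ, deriv f₆ t ≠ 0)
    (φ : (Fin 6 → ℝ) → ℝ) (hφ : ContDiff ℝ 2 φ)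
    -- (i) ∂₁φ = 0, ∂₂φ = 0, ∂₃φ = 0
    (h1 : ∀ x, pd 0 φ x = 0) (h2 : ∀ x, pd 1 φ x = 0) (h3 : ∀ x, pd 2 φ x = 0)
    -- (ii) ∂₅∂₆φ = 0 and ∂₄∂_τφ = 0  (τ = 5, 6)
    (h56 : ∀ x, pd 4 (pd 5 φ) x = 0)
    (h45 : ∀ x, pd 3 (pd 4 φ) x = 0) (h46 : ∀ x, pd 3 (pd 5 φ) x = 0)
    -- (iii) 4ε·∂_τφ = f_τ′·∂₄φ  (τ = 5, 6)
    (h4τ5 : ∀ x, 4 * ε * pd 4 φ x = deriv f₅ (x 4) * pd 3 φ x)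
    (h4τ6 : ∀ x, 4 * ε * pd 5 φ x = deriv f₆ (x 5) * pd 3 φ x)
    -- (iv) f_τ′·∂_τ∂_τφ = f_τ″·∂_τφ  (τ = 5, 6)
    (h55 : ∀ x, deriv f₅ (x 4) * pd 4 (pd 4 φ) x = deriv (deriv f₅) (x 4) * pd 4 φ x)
    (h66 : ∀ x, deriv f₆ (x 5) * pd 5 (pd 5 φ) x = deriv (deriv f₆) (x 5) * pd 5 φ x)
    -- (v) f₆′(x⁶)·∂₅φ = f₅′(x⁵)·∂₆φ
    (hprop : ∀ x, deriv f₆ (x 5) * pd 4 φ x = deriv f₅ (x 4) * pd 5 φ x) :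
    ∃ a₁ c : ℝ, ∀ x : Fin 6 → ℝ,
      φ x = 2 * a₁ * ε * x 3 + (a₁ / 2) * (f₅ (x 4) + f₆ (x 5)) + c := by
  have hzero {i : Fin 6} (h : ∀ x, pd i φ x = 0) (x : Fin 6 → ℝ) : pd i (pd 4 φ) x = 0 := by
    rw [pd_comm hφ, show pd i φ = fun _ => 0 from funext h]
    simp [pd]
  obtain ⟨b, hb⟩ := exists_pd_eq_mul_deriv (k := 4) hφ hf₅ hf₅' (fun i hi => by
    fin_cases i
    · exact hzero h1
    · exact hzero h2
    · exact hzero h3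
    · exact h45
    · exact absurd rfl hi
    · exact fun x => (pd_comm hφ 5 4 x).trans (h56 x)) h55
  have hb3 (x : Fin 6 → ℝ) : pd 3 φ x = 4 * b * ε := by
    refine mul_left_cancel₀ (hf₅' (x 4)) ?_
    rw [← h4τ5, hb]
    ring
  have hb5 (x : Fin 6 → ℝ) : pd 5 φ x = b * deriv f₆ (x 5) := by
    refine mul_left_cancel₀ (hf₅' (x 4)) ?_
    rw [← hprop, hb]
    ring
  have hd {f : ℝ → ℝ} (hf : ContDiff ℝ 2 f) (s : ℝ) : HasDerivAt f (deriv f s) s :=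
    (hf.differentiable (by norm_num) s).hasDerivAt
  have hψ (x : Fin 6 → ℝ) := (hφ.differentiable (by norm_num) x).hasFDerivAt.sub
    (((((hasDerivAt_id (x 3)).const_mul (4 * b * ε)).hasFDerivAt_comp_coord).add
      ((hd hf₅ (x 4)).const_mul b).hasFDerivAt_comp_coord).add
      ((hd hf₆ (x 5)).const_mul b).hasFDerivAt_comp_coord)
  have hconst := eq_of_pd_eq_zero (fun x => (hψ x).differentiableAt) fun i x => by
    have e1 := h1 x
    have e2 := h2 x
    have e3 := h3 x
    have e4 := hb3 x
    have e5 := hb x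
    have e6 := hb5 x
    rw [pd] at e1 e2 e3 e4 e5 e6 ⊢
    rw [(hψ x).fderiv]
    fin_cases i <;> simp [e1, e2, e3, e4, e5, e6]
  refine ⟨2 * b, φ 0 - b * f₅ 0 - b * f₆ 0, fun x => ?_⟩
  have h := hconst x 0
  simp only [Pi.sub_apply, Pi.add_apply, Pi.zero_apply, id] at h
  linear_combination h
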